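/- Let v : ℝ^d → ℝ be Lipschitz and compactly supported, and let φ be its Hopf–Lax function for quadratic cost, with ∇φ the almost-everywhere spatial gradient. Then φ(0,·) − v is nonnegative, compactly supported and integrable, the function (t,x) ↦ |∇φ(t,x)|² is integrable on (0,1)×ℝ^d, and ∫₀¹ ∫_{ℝ^d} (1/2)|∇φ(t,x)|² dx dt = ∫_{ℝ^d} (φ(0,x) − v(x)) dx. -/

import Mathlib

open MeasureTheory Set

/-- The Hopf–Lax function for quadratic cost with terminal datum `v` at time `1`:
`φ(t,x) = sup_y ( v(y) - |x-y|²/(2(1-t)) )` for `t < 1`, and `φ(1,x) = v(x)`. -/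
noncomputable def hopfLax (d : ℕ) (v : EuclideanSpace ℝ (Fin d) → ℝ)
    (t : ℝ) (x : EuclideanSpace ℝ (Fin d)) : ℝ :=
  if t = 1 then v x
  else ⨆ y : EuclideanSpace ℝ (Fin d), (v y - ‖x - y‖ ^ 2 / (2 * (1 - t)))

lemma hl_lip {d : ℕ} {v : EuclideanSpace ℝ (Fin d) → ℝ} {L : NNReal}
    (hL : LipschitzWith L v) (x y : EuclideanSpace ℝ (Fin d)) :
    v y ≤ v x + L * ‖x - y‖ := by
  have h := hL.dist_le_mul y x
  rw [Real.dist_eq, dist_comm, dist_eq_norm] at h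
  linarith [le_abs_self (v y - v x)]

lemma hl_bound {d : ℕ} {v : EuclideanSpace ℝ (Fin d) → ℝ} {L : NNReal}
    (hL : LipschitzWith L v) {s : ℝ} (hs : 0 < s) (x y : EuclideanSpace ℝ (Fin d)) :
    v y - ‖x - y‖ ^ 2 / (2 * s) ≤ v x + (L : ℝ) ^ 2 / 2 * s := by
  have h := hl_lip hL x y
  have h2 : L * ‖x - y‖ - ‖x - y‖ ^ 2 / (2 * s) ≤ (L : ℝ) ^ 2 / 2 * s := by
    have : (L : ℝ) ^ 2 / 2 * s - (L * ‖x - y‖ - ‖x - y‖ ^ 2 / (2 * s))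
      = (L * s - ‖x - y‖) ^ 2 / (2 * s) := by field_simp; ring
    have h3 : 0 ≤ (L * s - ‖x - y‖) ^ 2 / (2 * s) := by positivity
    linarith
  linarith

lemma hl_bdd {d : ℕ} {v : EuclideanSpace ℝ (Fin d) → ℝ} {L : NNReal}
    (hL : LipschitzWith L v) {s : ℝ} (hs : 0 < s) (x : EuclideanSpace ℝ (Fin d)) :
    BddAbove (range fun y => v y - ‖x - y‖ ^ 2 / (2 * s)) := by
  refine ⟨v x + (L : ℝ) ^ 2 / 2 * s, ?_⟩
  rintro _ ⟨y, rfl⟩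
  exact hl_bound hL hs x y

lemma hl_ge {d : ℕ} {v : EuclideanSpace ℝ (Fin d) → ℝ} {L : NNReal}
    (hL : LipschitzWith L v) {t : ℝ} (ht : t < 1) (x y : EuclideanSpace ℝ (Fin d)) :
    v y - ‖x - y‖ ^ 2 / (2 * (1 - t)) ≤ hopfLax d v t x := by
  rw [hopfLax, if_neg ht.ne]
  exact le_ciSup (hl_bdd hL (by linarith : 0 < 1 - t) x) y

lemma hl_le {d : ℕ} {v : EuclideanSpace ℝ (Fin d) → ℝ} {t : ℝ} (ht : t < 1)
    (x : EuclideanSpace ℝ (Fin d)) {c : ℝ}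
    (h : ∀ y, v y - ‖x - y‖ ^ 2 / (2 * (1 - t)) ≤ c) : hopfLax d v t x ≤ c := by
  rw [hopfLax, if_neg ht.ne]
  exact ciSup_le h

lemma hl_one {d : ℕ} {v : EuclideanSpace ℝ (Fin d) → ℝ} : hopfLax d v 1 = v := by
  funext x; simp [hopfLax]

lemma hl_ge_v {d : ℕ} {v : EuclideanSpace ℝ (Fin d) → ℝ} {L : NNReal}
    (hL : LipschitzWith L v) {t : ℝ} (ht : t ≤ 1) (x : EuclideanSpace ℝ (Fin d)) :
    v x ≤ hopfLax d v t x := by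
  rcases ht.lt_or_eq with h | h
  · simpa using hl_ge hL h x x
  · subst h; rw [hl_one]

lemma hl_anti {d : ℕ} {v : EuclideanSpace ℝ (Fin d) → ℝ} {L : NNReal}
    (hL : LipschitzWith L v) {t t' : ℝ} (h : t ≤ t') (ht' : t' ≤ 1)
    (x : EuclideanSpace ℝ (Fin d)) :
    hopfLax d v t' x ≤ hopfLax d v t x := by
  rcases ht'.lt_or_eq with h1 | h1
  · refine hl_le h1 x fun y => le_trans ?_ (hl_ge hL (h.trans_lt h1) x y)
    have : 0 < 1 - t' := by linarith
    gcongr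
  · subst h1; rw [hl_one]; exact hl_ge_v hL h x

lemma hl_time {d : ℕ} {v : EuclideanSpace ℝ (Fin d) → ℝ} {L : NNReal}
    (hL : LipschitzWith L v) {t t' : ℝ} (h : t ≤ t') (ht' : t' ≤ 1)
    (x : EuclideanSpace ℝ (Fin d)) :
    hopfLax d v t x ≤ hopfLax d v t' x + (L : ℝ) ^ 2 / 2 * (t' - t) := by
  rcases ht'.lt_or_eq with h1 | h1
  · refine hl_le (h.trans_lt h1) x fun y => ?_
    set s := 1 - t with hs
    set s' := 1 - t' with hs'
    have hs0 : 0 < s := by linarith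
    have hs0' : 0 < s' := by linarith
    have hss : s' ≤ s := by linarith
    set r := s' / s with hr
    have hr0 : 0 ≤ r := by positivity
    have hr1 : r ≤ 1 := by rw [hr, div_le_one hs0]; exact hss
    have h2 := hl_ge hL h1 x (x + r • (y - x))
    have e1 : ‖x - (x + r • (y - x))‖ = r * ‖x - y‖ := by
      rw [sub_add_cancel_left, norm_neg, norm_smul, Real.norm_of_nonneg hr0, norm_sub_rev]
    have e2 : ‖(x + r • (y - x)) - y‖ = (1 - r) * ‖x - y‖ := by
      have : (x + r • (y - x)) - y = (1 - r) • (x - y) := by module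
      rw [this, norm_smul, Real.norm_of_nonneg (by linarith)]
    have h3 := hl_lip hL (x + r • (y - x)) y
    rw [e1, ← hs'] at h2
    rw [e2] at h3
    have h4 := hl_bound hL hs0 x y
    set n := ‖x - y‖
    have e3 : (r * n) ^ 2 / (2 * s') = r * (n ^ 2 / (2 * s)) := by
      rw [hr]; field_simp
    have e4 : t' - t = (1 - r) * s := by
      rw [hr]; field_simp; rw [hs, hs']; ring
    have h5 : L * n - n ^ 2 / (2 * s) ≤ (L : ℝ) ^ 2 / 2 * s := by
      have : (L : ℝ) ^ 2 / 2 * s - (L * n - n ^ 2 / (2 * s))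
        = (L * s - n) ^ 2 / (2 * s) := by field_simp; ring
      have h3 : 0 ≤ (L * s - n) ^ 2 / (2 * s) := by positivity
      linarith
    rw [e3] at h2
    rw [e4]
    have h6 := mul_le_mul_of_nonneg_left h5 (by linarith : 0 ≤ 1 - r)
    nlinarith
  · subst h1
    rw [hl_one]
    rcases h.lt_or_eq with h2 | h2
    · exact hl_le h2 x fun y => hl_bound hL (by linarith) x y
    · subst h2; simp [hl_one]

lemma hl_space {d : ℕ} {v : EuclideanSpace ℝ (Fin d) → ℝ} {L : NNReal}
    (hL : LipschitzWith L v) {t : ℝ} (ht : t ≤ 1) : LipschitzWith L (hopfLax d v t) := by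
  rcases ht.lt_or_eq with h1 | h1
  · refine LipschitzWith.of_le_add_mul L fun x x' => ?_
    refine hl_le h1 x fun y => ?_
    have h2 := hl_ge hL h1 x' (y + (x' - x))
    have h3 := hl_lip hL (y + (x' - x)) y
    have e1 : x' - (y + (x' - x)) = x - y := by abel
    have e2 : y + (x' - x) - y = x' - x := by abel
    rw [e1] at h2
    rw [e2] at h3
    rw [dist_comm, dist_eq_norm]
    linarith
  · subst h1; rw [hl_one]; exact hL

/-- clamp of time -/
noncomputable def hlc (d : ℕ) (v : EuclideanSpace ℝ (Fin d) → ℝ)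
    (t : ℝ) (x : EuclideanSpace ℝ (Fin d)) : ℝ :=
  hopfLax d v (max 0 (min 1 t)) x

lemma hlc_eq {d : ℕ} {v : EuclideanSpace ℝ (Fin d) → ℝ} {t : ℝ} (h : t ∈ Icc (0 : ℝ) 1) :
    hlc d v t = hopfLax d v t := by
  funext x
  rw [hlc, min_eq_right h.2, max_eq_right h.1]

lemma clamp_le (t : ℝ) : max 0 (min 1 t) ≤ 1 := by simp

lemma hlc_time {d : ℕ} {v : EuclideanSpace ℝ (Fin d) → ℝ} {L : NNReal}
    (hL : LipschitzWith L v) (x : EuclideanSpace ℝ (Fin d)) :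
    LipschitzWith (L ^ 2 / 2) (fun t => hlc d v t x) := by
  refine LipschitzWith.of_le_add_mul _ fun t t' => ?_
  have hc : |max 0 (min 1 t) - max 0 (min 1 t')| ≤ |t - t'| := by
    refine (abs_max_sub_max_le_max _ _ _ _).trans ?_
    simp only [sub_self, abs_zero]
    refine max_le (abs_nonneg _) ((abs_min_sub_min_le_max _ _ _ _).trans ?_)
    simp
  have hc' : (0 : ℝ) ≤ (L : ℝ) ^ 2 / 2 := by positivity
  have hm := mul_le_mul_of_nonneg_left hc hc'
  simp only [hlc, Real.dist_eq, NNReal.coe_div, NNReal.coe_pow, NNReal.coe_ofNat]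
  rcases le_total (max 0 (min 1 t)) (max 0 (min 1 t')) with h | h
  · have := hl_time hL h (clamp_le t') x
    rw [abs_sub_comm, abs_of_nonneg (by linarith)] at hm
    linarith
  · have := hl_anti hL h (clamp_le t) x
    have : 0 ≤ (L : ℝ) ^ 2 / 2 * |t - t'| := by positivity
    linarith

lemma hlc_lip {d : ℕ} {v : EuclideanSpace ℝ (Fin d) → ℝ} {L : NNReal}
    (hL : LipschitzWith L v) :
    LipschitzWith (L ^ 2 / 2 + L) (Function.uncurry (hlc d v)) :=
  LipschitzWith.uncurry (hlc_time hL) (fun t => hl_space hL (clamp_le t))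

lemma hl_max {d : ℕ} {v : EuclideanSpace ℝ (Fin d) → ℝ} {L : NNReal}
    (hL : LipschitzWith L v) {t : ℝ} (ht : t < 1) (x : EuclideanSpace ℝ (Fin d)) :
    ∃ y, hopfLax d v t x = v y - ‖x - y‖ ^ 2 / (2 * (1 - t)) := by
  have hs : 0 < 1 - t := by linarith
  have hR : (0 : ℝ) ≤ 2 * L * (1 - t) := by positivity
  have hcont : Continuous fun y => v y - ‖x - y‖ ^ 2 / (2 * (1 - t)) := by
    have := hL.continuous
    fun_prop
  obtain ⟨y, hy, hmax⟩ := (isCompact_closedBall x (2 * L * (1 - t))).exists_isMaxOn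
    ⟨x, Metric.mem_closedBall_self hR⟩ hcont.continuousOn
  refine ⟨y, le_antisymm (hl_le ht x fun z => ?_) (hl_ge hL ht x y)⟩
  by_cases hz : z ∈ Metric.closedBall x (2 * L * (1 - t))
  · exact hmax hz
  · have h1 : v x - ‖x - x‖ ^ 2 / (2 * (1 - t)) ≤ _ := hmax (Metric.mem_closedBall_self hR)
    refine le_trans ?_ h1
    rw [Metric.mem_closedBall, not_le, dist_comm, dist_eq_norm] at hz
    have h2 := hl_lip hL x z
    have h3 : L * ‖x - z‖ ≤ ‖x - z‖ ^ 2 / (2 * (1 - t)) := by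
      rw [le_div_iff₀ (by positivity)]
      nlinarith [norm_nonneg (x - z)]
    simp
    linarith

lemma hl_zero {d : ℕ} {v : EuclideanSpace ℝ (Fin d) → ℝ} {L : NNReal}
    (hL : LipschitzWith L v) {R : ℝ} (hR : ∀ y, v y ≠ 0 → ‖y‖ ≤ R) {t : ℝ}
    (ht : t ∈ Icc (0 : ℝ) 1)
    {x : EuclideanSpace ℝ (Fin d)} (hx : R + 2 * L < ‖x‖) : hopfLax d v t x = 0 := by
  have hvx : v x = 0 := by
    by_contra h
    have := hR x h
    have : (0 : ℝ) ≤ L := L.2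
    linarith
  rcases ht.2.lt_or_eq with h1 | h1
  · refine le_antisymm (hl_le h1 x fun y => ?_) (hvx ▸ hl_ge_v hL ht.2 x)
    have hs : 0 < 1 - t := by linarith
    by_cases hy : v y = 0
    · rw [hy]
      have : 0 ≤ ‖x - y‖ ^ 2 / (2 * (1 - t)) := by positivity
      linarith
    · have h2 := hR y hy
      have h3 := norm_sub_norm_le x y
      have h4 := hl_lip hL x y
      have h5 : L * ‖x - y‖ ≤ ‖x - y‖ ^ 2 / (2 * (1 - t)) := by
        rw [le_div_iff₀ (by positivity)]
        have h6 : 2 * L ≤ ‖x - y‖ := by linarith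
        have h7 : 0 ≤ L * ‖x - y‖ := by positivity
        have := ht.1
        nlinarith [norm_nonneg (x - y)]
      linarith
  · rw [h1, hl_one, hvx]

lemma hl_grad {d : ℕ} {v : EuclideanSpace ℝ (Fin d) → ℝ} {L : NNReal}
    (hL : LipschitzWith L v) {t : ℝ} (ht : t < 1) {x y : EuclideanSpace ℝ (Fin d)}
    (hy : hopfLax d v t x = v y - ‖x - y‖ ^ 2 / (2 * (1 - t)))
    (hd : DifferentiableAt ℝ (hopfLax d v t) x) :
    ‖gradient (hopfLax d v t) x‖ = ‖x - y‖ / (1 - t) := by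
  have hs : 0 < 1 - t := by linarith
  have hg : HasFDerivAt (fun z => v y - ‖z - y‖ ^ 2 / (2 * (1 - t)))
      (-((1 - t)⁻¹ • innerSL ℝ (x - y))) x := by
    have h1 : HasFDerivAt (fun z : EuclideanSpace ℝ (Fin d) => ‖z - y‖ ^ 2)
        (2 • innerSL ℝ (x - y)) x := by
      have := ((hasFDerivAt_id (𝕜 := ℝ) x).sub_const y).norm_sq
      simpa using this
    have h2 := (h1.mul_const (2 * (1 - t))⁻¹).const_sub (v y)
    simp only [← div_eq_mul_inv] at h2
    have e : -((1 - t)⁻¹ • innerSL ℝ (x - y)) =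
        -((2 * (1 - t))⁻¹ • 2 • innerSL ℝ (x - y)) := by
      rw [← Nat.cast_smul_eq_nsmul ℝ 2, smul_smul]
      congr 2
      have := hs.ne'
      push_cast
      field_simp
    rw [e]
    exact h2
  have hmin : IsLocalMin (fun z => hopfLax d v t z - (v y - ‖z - y‖ ^ 2 / (2 * (1 - t)))) x := by
    refine Filter.Eventually.of_forall fun z => ?_
    have := hl_ge hL ht z y
    simp only
    linarith
  have h0 := hmin.hasFDerivAt_eq_zero (hd.hasFDerivAt.sub hg)
  rw [sub_eq_zero] at h0
  rw [gradient, LinearIsometryEquiv.norm_map, h0, norm_neg, norm_smul, innerSL_apply_norm,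
    Real.norm_of_nonneg (by positivity)]
  ring

lemma hl_dt {d : ℕ} {v : EuclideanSpace ℝ (Fin d) → ℝ} {L : NNReal}
    (hL : LipschitzWith L v) {t : ℝ} (ht : t < 1) {x y : EuclideanSpace ℝ (Fin d)}
    (hy : hopfLax d v t x = v y - ‖x - y‖ ^ 2 / (2 * (1 - t)))
    (hd : DifferentiableAt ℝ (fun t => hopfLax d v t x) t) :
    deriv (fun t => hopfLax d v t x) t = -(1 / 2 * (‖x - y‖ / (1 - t)) ^ 2) := by
  have hs : 0 < 1 - t := by linarith
  have hg : HasDerivAt (fun τ => v y - ‖x - y‖ ^ 2 / (2 * (1 - τ)))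
      (-(1 / 2 * (‖x - y‖ / (1 - t)) ^ 2)) t := by
    have h1 : HasDerivAt (fun τ : ℝ => 2 * (1 - τ)) (2 * (-1)) t :=
      ((hasDerivAt_id t).const_sub 1).const_mul 2
    have h2 := ((hasDerivAt_const t (‖x - y‖ ^ 2)).fun_div h1 (by positivity)).const_sub (v y)
    have e : -(1 / 2 * (‖x - y‖ / (1 - t)) ^ 2) =
        -((0 * (2 * (1 - t)) - ‖x - y‖ ^ 2 * (2 * -1)) / (2 * (1 - t)) ^ 2) := by
      have := hs.ne'
      field_simp
      ring
    rw [e]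
    exact h2
  have hmin : IsLocalMin
      (fun τ => hopfLax d v τ x - (v y - ‖x - y‖ ^ 2 / (2 * (1 - τ)))) t := by
    filter_upwards [Iio_mem_nhds ht] with τ hτ
    have := hl_ge hL hτ x y
    linarith
  have h0 := hmin.hasDerivAt_eq_zero (hd.hasDerivAt.sub hg)
  linarith

lemma hl_hj {d : ℕ} {v : EuclideanSpace ℝ (Fin d) → ℝ} {L : NNReal}
    (hL : LipschitzWith L v) :
    ∀ᵐ p : ℝ × EuclideanSpace ℝ (Fin d), p ∈ Ioo (0 : ℝ) 1 ×ˢ univ →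
      1 / 2 * ‖gradient (hopfLax d v p.1) p.2‖ ^ 2 = -deriv (fun t => hlc d v t p.2) p.1 := by
  have : (volume : Measure (ℝ × EuclideanSpace ℝ (Fin d))).IsAddHaarMeasure :=
    Measure.prod.instIsAddHaarMeasure volume volume
  filter_upwards [(hlc_lip hL).ae_differentiableAt] with p hp hmem
  obtain ⟨t, x⟩ := p
  have ht : t ∈ Ioo (0 : ℝ) 1 := hmem.1
  simp only
  have hloc : (fun t => hlc d v t x) =ᶠ[nhds t] (fun t => hopfLax d v t x) := by
    filter_upwards [Ioo_mem_nhds ht.1 ht.2] with τ hτ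
    rw [hlc_eq (Ioo_subset_Icc_self hτ)]
  have d1 : DifferentiableAt ℝ (hopfLax d v t) x := by
    have : DifferentiableAt ℝ (fun z => Function.uncurry (hlc d v) (t, z)) x :=
      DifferentiableAt.comp (f := fun z => (t, z)) x hp (by fun_prop)
    rw [← hlc_eq (Ioo_subset_Icc_self ht)]
    exact this
  have d2 : DifferentiableAt ℝ (fun t => hopfLax d v t x) t := by
    have : DifferentiableAt ℝ (fun τ => Function.uncurry (hlc d v) (τ, x)) t :=
      DifferentiableAt.comp (f := fun τ => (τ, x)) t hp (by fun_prop)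
    exact hloc.differentiableAt_iff.1 this
  obtain ⟨y, hy⟩ := hl_max hL ht.2 x
  rw [hloc.deriv_eq, hl_dt hL ht.2 hy d2, hl_grad hL ht.2 hy d1, neg_neg]

lemma hlc_deriv_integrable {d : ℕ} {v : EuclideanSpace ℝ (Fin d) → ℝ} {L : NNReal}
    (hL : LipschitzWith L v) {R : ℝ} (hR : ∀ y, v y ≠ 0 → ‖y‖ ≤ R) :
    IntegrableOn (fun p : ℝ × EuclideanSpace ℝ (Fin d) => deriv (fun t => hlc d v t p.2) p.1)
      (Ioo (0 : ℝ) 1 ×ˢ univ) := by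
  have hmeas : Measurable
      (fun p : ℝ × EuclideanSpace ℝ (Fin d) => deriv (fun t => hlc d v t p.2) p.1) := by
    have hc : Continuous (Function.uncurry fun (x : EuclideanSpace ℝ (Fin d)) t => hlc d v t x) :=
      (hlc_lip hL).continuous.comp continuous_swap
    have h := measurable_deriv_with_param hc
    have h' := h.comp (measurable_swap (α := ℝ) (β := EuclideanSpace ℝ (Fin d)))
    exact h'
  have hbd : ∀ p : ℝ × EuclideanSpace ℝ (Fin d),
      ‖deriv (fun t => hlc d v t p.2) p.1‖ ≤ ((L ^ 2 / 2 : NNReal) : ℝ) := fun p =>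
    norm_deriv_le_of_lipschitz (hlc_time hL p.2)
  have hfin : volume (Ioo (0 : ℝ) 1 ×ˢ
      Metric.closedBall (0 : EuclideanSpace ℝ (Fin d)) (R + 2 * L)) < ⊤ := by
    rw [Measure.volume_eq_prod, Measure.prod_prod]
    exact ENNReal.mul_lt_top (by simp) measure_closedBall_lt_top
  have h1 : IntegrableOn
      (fun p : ℝ × EuclideanSpace ℝ (Fin d) => deriv (fun t => hlc d v t p.2) p.1)
      (Ioo (0 : ℝ) 1 ×ˢ Metric.closedBall (0 : EuclideanSpace ℝ (Fin d)) (R + 2 * L)) :=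
    Measure.integrableOn_of_bounded hfin.ne hmeas.aestronglyMeasurable
      (Filter.Eventually.of_forall hbd)
  refine h1.of_forall_sdiff_eq_zero (measurableSet_Ioo.prod MeasurableSet.univ) ?_
  rintro ⟨t, x⟩ ⟨h2, h3⟩
  have hx : R + 2 * L < ‖x‖ := by
    by_contra hx
    exact h3 ⟨h2.1, by simpa using hx⟩
  have : (fun t => hlc d v t x) = fun _ => 0 := by
    funext τ
    exact hl_zero hL hR ⟨le_max_left _ _, clamp_le τ⟩ hx
  simp [this]

/-- For Lipschitz compactly supported `v`, the energy identity
`∫₀¹∫ (1/2)|∇φ|² dx dt = ∫ (φ(0,x) - v(x)) dx` holds, the integrand on the right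
being nonnegative, compactly supported and integrable, and `|∇φ|²` being
integrable on `(0,1) × ℝ^d`. -/
theorem hopfLax_energy_identity
    (d : ℕ) (v : EuclideanSpace ℝ (Fin d) → ℝ) (L : NNReal)
    (hL : LipschitzWith L v) (hsupp : HasCompactSupport v) :
    (∀ x, 0 ≤ hopfLax d v 0 x - v x) ∧
    HasCompactSupport (fun x => hopfLax d v 0 x - v x) ∧
    Integrable (fun x => hopfLax d v 0 x - v x) ∧
    IntegrableOn
      (fun p : ℝ × EuclideanSpace ℝ (Fin d) =>
        ‖gradient (hopfLax d v p.1) p.2‖ ^ 2)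
      (Ioo (0 : ℝ) 1 ×ˢ (univ : Set (EuclideanSpace ℝ (Fin d)))) ∧
    ∫ p in Ioo (0 : ℝ) 1 ×ˢ (univ : Set (EuclideanSpace ℝ (Fin d))),
        (1 / 2) * ‖gradient (hopfLax d v p.1) p.2‖ ^ 2
      = ∫ x, (hopfLax d v 0 x - v x) := by
  obtain ⟨R, hR'⟩ := hsupp.isBounded.exists_norm_le
  have hR : ∀ y, v y ≠ 0 → ‖y‖ ≤ R := fun y hy => hR' y (subset_tsupport v hy)
  have hcs : HasCompactSupport (fun x => hopfLax d v 0 x - v x) := by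
    refine HasCompactSupport.intro (isCompact_closedBall 0 (R + 2 * L)) fun x hx => ?_
    have hx' : R + 2 * L < ‖x‖ := by simpa using hx
    have h1 := hl_zero hL hR (t := 1) (by simp) hx'
    rw [hl_one] at h1
    rw [hl_zero hL hR (t := 0) (by simp) hx', h1, sub_zero]
  have hcont : Continuous (fun x => hopfLax d v 0 x - v x) :=
    (hl_space hL zero_le_one).continuous.sub hL.continuous
  have hD := hlc_deriv_integrable hL hR
  have hms : MeasurableSet (Ioo (0 : ℝ) 1 ×ˢ (univ : Set (EuclideanSpace ℝ (Fin d)))) :=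
    measurableSet_Ioo.prod MeasurableSet.univ
  have hae := (ae_restrict_iff' hms).2 (hl_hj (d := d) hL)
  refine ⟨fun x => sub_nonneg.2 (hl_ge_v hL zero_le_one x), hcs,
    hcont.integrable_of_hasCompactSupport hcs, ?_, ?_⟩
  · refine (hD.const_mul (-2)).congr ?_
    filter_upwards [hae] with p hp
    linarith
  · rw [integral_congr_ae hae]
    rw [IntegrableOn, Measure.volume_eq_prod, ← Measure.prod_restrict, Measure.restrict_univ] at hD
    rw [Measure.volume_eq_prod, ← Measure.prod_restrict, Measure.restrict_univ,
      integral_neg, integral_prod_symm _ hD, ← integral_neg]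
    refine integral_congr_ae (Filter.Eventually.of_forall fun x => ?_)
    have h := ((hlc_time hL x).lipschitzOnWith
      (s := uIcc 0 1)).absolutelyContinuousOnInterval.integral_deriv_eq_sub
    rw [intervalIntegral.integral_of_le zero_le_one, integral_Ioc_eq_integral_Ioo] at h
    simp only
    rw [h, hlc_eq (by simp), hlc_eq (by simp), hl_one]
    ring
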